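/- (Uniqueness of the interpolating Newton series.) Let k be a nonempty index. If a sequence of complex numbers (a_n)_{n≥0} satisfies Σ_{n=0}^{N} a_n·binom(N,n) = S⋆(k,N) for every integer N≥0, then a_0=0 and a_n=(−1)^{n−1} s⋆(k∨,n) for all n≥1. -/

import Mathlib

open MeasureTheory Filter Topology

namespace Kawashima

/-- The set `A(k) = {k₁, k₁+k₂, …, k₁+⋯+k_{r-1}}` of proper nonempty partial sums
of an index `k = (k₁, …, k_r)`. -/
def Aset (k : List ℕ) : Finset ℕ :=
  (Finset.Ico 1 k.length).image (fun i => (k.take i).sum)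

/-- The Hoffman dual of an index `k`: the unique index `k∨` with the same weight such
that `A(k)` and `A(k∨)` partition `{1, …, wt(k) - 1}`.  It is computed here as the
composition of `wt(k)` whose partial-sum set is the complement of `A(k)`. -/
def hdual (k : List ℕ) : List ℕ :=
  let w := k.sum
  let L := (insert w ((Finset.Icc 1 (w - 1)) \ Aset k)).sort (· ≤ ·)
  L.zipWith (fun a b => a - b) (0 :: L)

/-- `sStar k N = s⋆(k, N) = Σ_{0 < m₁ ≤ ⋯ ≤ m_{r-1} ≤ m_r = N} 1/(m₁^{k₁} ⋯ m_r^{k_r})`.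
For the empty index the value is `1` (empty product), and for a nonempty index and
`N = 0` the value is `0` (empty sum). -/
noncomputable def sStar (k : List ℕ) (N : ℕ) : ℝ :=
  ∑ m : Fin k.length → Fin (N + 1),
    if (∀ i, 0 < (m i : ℕ)) ∧
       (∀ i j : Fin k.length, i ≤ j → (m i : ℕ) ≤ (m j : ℕ)) ∧
       (∀ i : Fin k.length, (i : ℕ) + 1 = k.length → (m i : ℕ) = N)
    then ∏ i : Fin k.length, 1 / ((m i : ℕ) : ℝ) ^ k.get i
    else 0

/-- `SStar k N = S⋆(k, N) = Σ_{n=1}^N s⋆(k, n)`. -/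
noncomputable def SStar (k : List ℕ) (N : ℕ) : ℝ :=
  ∑ n ∈ Finset.Icc 1 N, sStar k n

/-- The binomial coefficient `binom(z, n) = z(z-1)⋯(z-n+1)/n!` for complex `z`. -/
noncomputable def cbinom (z : ℂ) (n : ℕ) : ℂ :=
  (descPochhammer ℂ n).eval z / (n.factorial : ℂ)

/-- The Kawashima function
`F_k(z) = Σ_{n=1}^∞ (-1)^{n-1} s⋆(k∨, n) binom(z, n)`, with `F_∅(z) = 1`. -/
noncomputable def F (k : List ℕ) (z : ℂ) : ℂ :=
  if k = [] then 1
  else ∑' n : ℕ, (-1 : ℂ) ^ n * ((sStar (hdual k) (n + 1) : ℝ) : ℂ) * cbinom z (n + 1)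

/-- The domain `Δ(k) ⊆ (0,1)^{wt(k)}`: `t_j < t_{j+1}` if `j ∈ A(k)` and
`t_j > t_{j+1}` otherwise (positions `1`-indexed). -/
def Delta (k : List ℕ) : Set (Fin k.sum → ℝ) :=
  {t | (∀ j, t j ∈ Set.Ioo (0 : ℝ) 1) ∧
       ∀ (i : Fin k.sum) (h : (i : ℕ) + 1 < k.sum),
         if (i : ℕ) + 1 ∈ Aset k then t i < t ⟨(i : ℕ) + 1, h⟩
         else t ⟨(i : ℕ) + 1, h⟩ < t i}

/-- The multiple zeta value `ζ(k) = Σ_{0 < m₁ < ⋯ < m_r} 1/(m₁^{k₁} ⋯ m_r^{k_r})`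
(as a `tsum`; it converges for admissible `k`), with `ζ(∅) = 1`. -/
noncomputable def mzv (k : List ℕ) : ℝ :=
  ∑' m : Fin k.length → ℕ,
    if (∀ i, 0 < m i) ∧ (∀ i j : Fin k.length, i < j → m i < m j)
    then ∏ i : Fin k.length, 1 / ((m i : ℕ) : ℝ) ^ k.get i
    else 0

/-- `ζ` extended `ℚ`-linearly to formal `ℚ`-linear combinations of indices. -/
noncomputable def zetaL (v : List ℕ →₀ ℚ) : ℝ :=
  v.sum fun k a => (a : ℝ) * mzv k

/-- The Kawashima function extended `ℚ`-linearly to formal combinations of indices. -/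
noncomputable def FL (v : List ℕ →₀ ℚ) (z : ℂ) : ℂ :=
  v.sum fun k a => (a : ℂ) * F k z

/-- Auxiliary harmonic product, on *reversed* indices (so that the rightmost entry of
the index is the head of the list):
`k * l = (k₋ * l, k_r) + (k * l₋, l_s) + (k₋ * l₋, k_r + l_s)`. -/
noncomputable def hstarAux : List ℕ → List ℕ → (List ℕ →₀ ℚ)
  | [], l => Finsupp.single l 1
  | a :: k, [] => Finsupp.single (a :: k) 1
  | a :: k, b :: l =>
      Finsupp.mapDomain (List.cons a) (hstarAux k (b :: l)) +
      Finsupp.mapDomain (List.cons b) (hstarAux (a :: k) l) +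
      Finsupp.mapDomain (List.cons (a + b)) (hstarAux k l)
  termination_by k l => k.length + l.length

/-- The harmonic product `k * l` of two indices, as a `ℚ`-linear combination of
indices. -/
noncomputable def hstar (k l : List ℕ) : List ℕ →₀ ℚ :=
  Finsupp.mapDomain List.reverse (hstarAux k.reverse l.reverse)

/-- Auxiliary product `*̄` on reversed indices:
`k *̄ l = (k₋ *̄ l, k_r) + (k *̄ l₋, l_s) - (k₋ *̄ l₋, k_r + l_s)`. -/
noncomputable def hbarAux : List ℕ → List ℕ → (List ℕ →₀ ℚ)
  | [], l => Finsupp.single l 1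
  | a :: k, [] => Finsupp.single (a :: k) 1
  | a :: k, b :: l =>
      Finsupp.mapDomain (List.cons a) (hbarAux k (b :: l)) +
      Finsupp.mapDomain (List.cons b) (hbarAux (a :: k) l) -
      Finsupp.mapDomain (List.cons (a + b)) (hbarAux k l)
  termination_by k l => k.length + l.length

/-- The harmonic product `k *̄ l` of two indices. -/
noncomputable def hbar (k l : List ℕ) : List ℕ →₀ ℚ :=
  Finsupp.mapDomain List.reverse (hbarAux k.reverse l.reverse)

/-- The product `k ⊛ l = (k₋ * l₋, k_r + l_s)` for nonempty indices `k`, `l`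
(and `0` if either is empty). -/
noncomputable def circAst (k l : List ℕ) : List ℕ →₀ ℚ :=
  match k.reverse, l.reverse with
  | a :: k', b :: l' =>
      Finsupp.mapDomain List.reverse
        (Finsupp.mapDomain (List.cons (a + b)) (hstarAux k' l'))
  | _, _ => 0

/-- `⊛` extended bilinearly to formal combinations. -/
noncomputable def circAstL (v w : List ℕ →₀ ℚ) : List ℕ →₀ ℚ :=
  v.sum fun k a => w.sum fun l b => (a * b) • circAst k l

/-- The star operator `k ↦ k⋆`: the sum over all ways to replace commas by pluses
in groups of consecutive entries,
`(k₁,…,k_r)⋆ = Σ_{0<j₁<⋯<j_q=r} (k₁+⋯+k_{j₁}, …, k_{j_{q-1}+1}+⋯+k_{j_q})`. -/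
noncomputable def starOp : List ℕ → (List ℕ →₀ ℚ)
  | [] => Finsupp.single [] 1
  | [a] => Finsupp.single [a] 1
  | a :: b :: k =>
      Finsupp.mapDomain (List.cons a) (starOp (b :: k)) + starOp ((a + b) :: k)
  termination_by k => k.length

/-- The star operator extended `ℚ`-linearly. -/
noncomputable def starL (v : List ℕ →₀ ℚ) : List ℕ →₀ ℚ :=
  v.sum fun k a => a • starOp k

open Classical in
/-- Kawashima's function `G_k(z)`: the sum over tuples `0 < n₁, …, n_w` with
`n_j < n_{j+1}` if `j ∉ A(k)` and `n_j ≤ n_{j+1}` if `j ∈ A(k)`, of the product of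
the factors `1/(n_j + z)` at positions `j ∈ A(k)`, the factor
`1/n_w - 1/(n_w + z)` at the last position, and `1/n_j` elsewhere. -/
noncomputable def G (k : List ℕ) (z : ℂ) : ℂ :=
  ∑' n : Fin k.sum → ℕ,
    if (∀ j, 0 < n j) ∧
       (∀ (i : Fin k.sum) (h : (i : ℕ) + 1 < k.sum),
          if (i : ℕ) + 1 ∈ Aset k then n i ≤ n ⟨(i : ℕ) + 1, h⟩
          else n i < n ⟨(i : ℕ) + 1, h⟩)
    then ∏ j : Fin k.sum,
      if (j : ℕ) + 1 = k.sum then 1 / ((n j : ℕ) : ℂ) - 1 / (((n j : ℕ) : ℂ) + z)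
      else if (j : ℕ) + 1 ∈ Aset k then 1 / (((n j : ℕ) : ℂ) + z)
      else 1 / ((n j : ℕ) : ℂ)
    else 0

open Classical in
/-- `ζ_k(l) = Σ 1/(n₁^{l₁} ⋯ n_w^{l_w})`, summed over the same set of tuples as in
the definition of `G_k`. -/
noncomputable def zetaIdx (k : List ℕ) (l : List ℕ) : ℝ :=
  ∑' n : Fin k.sum → ℕ,
    if (∀ j, 0 < n j) ∧
       (∀ (i : Fin k.sum) (h : (i : ℕ) + 1 < k.sum),
          if (i : ℕ) + 1 ∈ Aset k then n i ≤ n ⟨(i : ℕ) + 1, h⟩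
          else n i < n ⟨(i : ℕ) + 1, h⟩)
    then ∏ j : Fin k.sum, 1 / ((n j : ℕ) : ℝ) ^ (l.getD (j : ℕ) 0)
    else 0

/-- `C_m(k) = Σ_{l₁,…,l_{r-1} ≥ 0, l_r ≥ 1, l₁+⋯+l_r = m}
ζ_k(1,…,1 (k₁-1 ones), l₁+1, …, 1,…,1 (k_r-1 ones), l_r+1)`. -/
noncomputable def Cm (k : List ℕ) (m : ℕ) : ℝ :=
  ∑ l : Fin k.length → Fin (m + 1),
    if (∑ i, (l i : ℕ)) = m ∧
       (∀ i : Fin k.length, (i : ℕ) + 1 = k.length → 1 ≤ (l i : ℕ))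
    then zetaIdx k
      ((List.ofFn (fun i : Fin k.length =>
          List.replicate (k.get i - 1) 1 ++ [(l i : ℕ) + 1])).flatten)
    else 0

/-- The iterated integral `A_m(k)` over `Δ((k,1,…,1))` (`m` trailing ones) of
`ω_{δ(1)}(t₁) ⋯ ω_{δ(w-1)}(t_{w-1}) · dt_w/(1-t_w) · dt_{w+1}/t_{w+1} ⋯ dt_{w+m}/t_{w+m}`. -/
noncomputable def Aint (k : List ℕ) (m : ℕ) : ℝ :=
  ∫ t in Delta (k ++ List.replicate m 1),
    ∏ i : Fin (k ++ List.replicate m 1).sum,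
      if (i : ℕ) + 1 < k.sum then
        (if (i : ℕ) + 1 ∈ Aset k then 1 / (1 - t i) else 1 / t i)
      else if (i : ℕ) + 1 = k.sum then 1 / (1 - t i)
      else 1 / t i

/-- The digamma function `ψ(z) = Γ'(z)/Γ(z)`. -/
noncomputable def digamma (z : ℂ) : ℂ := deriv Complex.Gamma z / Complex.Gamma z


/-- Weakly increasing `r`-tuples of integers in `{1, …, N}`. -/
def monoTuples (r N : ℕ) : Finset (Fin r → ℕ) :=
  (Fintype.piFinset fun _ => Finset.Icc 1 N).filter fun m => ∀ i j, i ≤ j → m i ≤ m j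

lemma mem_monoTuples {r N : ℕ} {m : Fin r → ℕ} :
    m ∈ monoTuples r N ↔ (∀ i, 1 ≤ m i ∧ m i ≤ N) ∧ ∀ i j, i ≤ j → m i ≤ m j := by
  simp [monoTuples]

lemma snoc_mem_monoTuples {r N n : ℕ} {m : Fin r → ℕ} (hn : n ∈ Finset.Icc 1 N)
    (hm : m ∈ monoTuples r n) :
    (Fin.snoc m n : Fin (r + 1) → ℕ) ∈ monoTuples (r + 1) N := by
  rw [Finset.mem_Icc] at hn
  rw [mem_monoTuples] at hm ⊢
  refine ⟨fun i => ?_, fun i j => ?_⟩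
  · induction i using Fin.lastCases with
    | last => simpa using hn
    | cast i => simpa using ⟨(hm.1 i).1, (hm.1 i).2.trans hn.2⟩
  · induction i using Fin.lastCases with
    | last =>
      intro h
      rw [Fin.last_le_iff] at h
      rw [h]
    | cast i =>
      induction j using Fin.lastCases with
      | last =>
        intro _
        simpa using (hm.1 i).2
      | cast j => simpa using hm.2 i j

lemma castSucc_mem_monoTuples {r N : ℕ} {m : Fin (r + 1) → ℕ} (hm : m ∈ monoTuples (r + 1) N) :
    (fun i : Fin r => m i.castSucc) ∈ monoTuples r (m (Fin.last r)) := by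
  rw [mem_monoTuples] at hm ⊢
  exact ⟨fun i => ⟨(hm.1 _).1, hm.2 _ _ (Fin.le_last _)⟩,
    fun i j h => hm.2 _ _ (Fin.castSucc_le_castSucc_iff.2 h)⟩

lemma sum_monoTuples_succ {r : ℕ} (N : ℕ) (f : (Fin (r + 1) → ℕ) → ℝ) :
    ∑ m ∈ monoTuples (r + 1) N, f m =
      ∑ n ∈ Finset.Icc 1 N, ∑ m ∈ monoTuples r n, f (Fin.snoc m n) := by
  rw [Finset.sum_sigma']
  refine Finset.sum_bij' (fun m _ => ⟨m (Fin.last r), fun i => m i.castSucc⟩)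
    (fun p _ => Fin.snoc p.2 p.1) ?_ ?_ ?_ ?_ ?_
  · intro m hm
    rw [Finset.mem_sigma, Finset.mem_Icc]
    exact ⟨(mem_monoTuples.1 hm).1 _, castSucc_mem_monoTuples hm⟩
  · rintro ⟨n, m⟩ hp
    rw [Finset.mem_sigma] at hp
    exact snoc_mem_monoTuples hp.1 hp.2
  · intro m _
    exact Fin.snoc_init_self m
  · rintro ⟨n, m⟩ _
    simp
  · intro m _
    exact congrArg f (Fin.snoc_init_self m).symm

/-- The sum of `1 / (m₁^{e₁} ⋯ m_r^{e_r})` over `1 ≤ m₁ ≤ ⋯ ≤ m_r ≤ N`. -/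
noncomputable def truncStar {r : ℕ} (e : Fin r → ℕ) (N : ℕ) : ℝ :=
  ∑ m ∈ monoTuples r N, ∏ i, 1 / (m i : ℝ) ^ e i

lemma truncStar_zero (e : Fin 0 → ℕ) (N : ℕ) : truncStar e N = 1 := by
  have h : monoTuples 0 N = Finset.univ := by
    refine Finset.eq_univ_of_forall fun m => mem_monoTuples.2 ⟨fun i => i.elim0, fun i => i.elim0⟩
  simp [truncStar, h]

lemma truncStar_succ {r : ℕ} (e : Fin (r + 1) → ℕ) (N : ℕ) :
    truncStar e N = ∑ n ∈ Finset.Icc 1 N,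
      1 / (n : ℝ) ^ e (Fin.last r) * truncStar (fun i => e i.castSucc) n := by
  simp only [truncStar, sum_monoTuples_succ, Fin.prod_univ_castSucc, Fin.snoc_castSucc,
    Fin.snoc_last, Finset.mul_sum]
  exact Finset.sum_congr rfl fun n _ => Finset.sum_congr rfl fun m _ => mul_comm _ _

lemma sum_fin_tuples_eq_truncStar {r N : ℕ} (e : Fin (r + 1) → ℕ) (hN : 1 ≤ N) :
    (∑ m : Fin (r + 1) → Fin (N + 1),
      if (∀ i, 0 < (m i : ℕ)) ∧
         (∀ i j : Fin (r + 1), i ≤ j → (m i : ℕ) ≤ (m j : ℕ)) ∧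
         (∀ i : Fin (r + 1), (i : ℕ) + 1 = r + 1 → (m i : ℕ) = N)
      then ∏ i, 1 / ((m i : ℕ) : ℝ) ^ e i else 0) =
      1 / (N : ℝ) ^ e (Fin.last r) * truncStar (fun i => e i.castSucc) N := by
  rw [← Finset.sum_filter, truncStar, Finset.mul_sum]
  have hNN : N ∈ Finset.Icc 1 N := Finset.mem_Icc.2 ⟨hN, le_rfl⟩
  have val_mem : ∀ m : Fin (r + 1) → Fin (N + 1), (∀ i, 0 < (m i : ℕ)) →
      (∀ i j : Fin (r + 1), i ≤ j → (m i : ℕ) ≤ (m j : ℕ)) →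
      (fun i => (m i : ℕ)) ∈ monoTuples (r + 1) N := fun m h₁ h₂ =>
    mem_monoTuples.2 ⟨fun i => ⟨h₁ i, Nat.lt_succ_iff.1 (m i).2⟩, h₂⟩
  refine Finset.sum_bij (fun m _ => fun i : Fin r => (m i.castSucc : ℕ)) ?_ ?_ ?_ ?_
  · intro m hm
    obtain ⟨h₁, h₂, h₃⟩ := (Finset.mem_filter.1 hm).2
    simpa [h₃ (Fin.last r) rfl] using castSucc_mem_monoTuples (val_mem m h₁ h₂)
  · intro m hm m' hm' h
    obtain ⟨-, -, h₃⟩ := (Finset.mem_filter.1 hm).2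
    obtain ⟨-, -, h₃'⟩ := (Finset.mem_filter.1 hm').2
    funext i
    apply Fin.ext
    induction i using Fin.lastCases with
    | last => rw [h₃ _ rfl, h₃' _ rfl]
    | cast i => exact congrFun h i
  · intro m hm
    have hs := mem_monoTuples.1 (snoc_mem_monoTuples hNN hm)
    refine ⟨fun i => ⟨(Fin.snoc m N : Fin (r + 1) → ℕ) i, Nat.lt_succ_iff.2 (hs.1 i).2⟩,
      Finset.mem_filter.2 ⟨Finset.mem_univ _, fun i => (hs.1 i).1, hs.2, fun i hi => ?_⟩, ?_⟩
    · obtain rfl : i = Fin.last r := Fin.ext (by simpa using hi)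
      simp
    · funext i
      simp
  · intro m hm
    obtain ⟨-, -, h₃⟩ := (Finset.mem_filter.1 hm).2
    rw [Fin.prod_univ_castSucc, h₃ _ rfl, mul_comm]

lemma sStar_eq_truncStar {r N : ℕ} (k : List ℕ) (hk : k.length = r + 1) (hN : 1 ≤ N) :
    sStar k N = 1 / (N : ℝ) ^ k.get ((Fin.last r).cast hk.symm) *
      truncStar (fun i : Fin r => k.get (i.castSucc.cast hk.symm)) N := by
  rw [← sum_fin_tuples_eq_truncStar (fun i => k.get (i.cast hk.symm)) hN, sStar]
  generalize hg : k.get = g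
  clear hg
  generalize k.length = s at hk g
  subst hk
  rfl

lemma sStar_concat {N : ℕ} (l : List ℕ) (c : ℕ) (hN : 1 ≤ N) :
    sStar (l ++ [c]) N = 1 / (N : ℝ) ^ c * truncStar l.get N := by
  rw [sStar_eq_truncStar (l ++ [c]) (r := l.length) (by simp) hN]
  simp only [List.get_eq_getElem, Fin.val_cast, Fin.val_last, Fin.val_castSucc,
    List.getElem_concat_length, Fin.is_lt, List.getElem_append_left]
  rfl

lemma SStar_concat (l : List ℕ) (c N : ℕ) :
    SStar (l ++ [c]) N = truncStar (l ++ [c]).get N := by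
  have key : ∀ (k : List ℕ) (r : ℕ) (hk : k.length = r + 1), SStar k N = truncStar k.get N := by
    intro k r hk
    rw [SStar, Finset.sum_congr rfl fun n hn =>
      sStar_eq_truncStar k hk (Finset.mem_Icc.1 hn).1]
    have h := truncStar_succ (fun i => k.get (i.cast hk.symm)) N
    rw [← h]
    generalize hg : k.get = g
    clear hg h
    generalize k.length = s at hk g
    subst hk
    rfl
  exact key _ l.length (by simp)

lemma sStar_concat_succ {N : ℕ} (l : List ℕ) (c : ℕ) (hN : 1 ≤ N) :
    sStar (l ++ [c + 1]) N = sStar (l ++ [c]) N / N := by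
  rw [sStar_concat _ _ hN, sStar_concat _ _ hN, pow_succ]
  have : (N : ℝ) ≠ 0 := by positivity
  field_simp

lemma sStar_concat_concat_one {N : ℕ} (l : List ℕ) (c : ℕ) (hN : 1 ≤ N) :
    sStar (l ++ [c] ++ [1]) N = SStar (l ++ [c]) N / N := by
  rw [sStar_concat _ _ hN, SStar_concat, pow_one, one_div_mul_eq_div]

lemma SStar_eq_sum_range (k : List ℕ) (N : ℕ) :
    SStar k N = ∑ n ∈ Finset.range N, sStar k (n + 1) := by
  rw [SStar, ← Finset.Ico_add_one_right_eq_Icc, Finset.sum_Ico_eq_sum_range]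
  exact Finset.sum_congr (by simp) fun n _ => by rw [add_comm]

lemma sStar_singleton_one {N : ℕ} (hN : 1 ≤ N) : sStar [1] N = 1 / N := by
  have h := sStar_concat [] 1 hN
  rw [truncStar_zero] at h
  simpa using h

/-- The alternating binomial transform `g ↦ (n ↦ ∑ₘ (-1)^m binom(n, m) g(m))`. -/
noncomputable def binomTransform (g : ℕ → ℝ) (n : ℕ) : ℝ :=
  ∑ m ∈ Finset.range (n + 1), (-1) ^ m * g m * n.choose m

lemma sum_range_sum_mul_choose (c : ℕ → ℝ) (n : ℕ) :
    ∑ i ∈ Finset.range n, ∑ m ∈ Finset.range (i + 1), c m * i.choose m =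
      ∑ m ∈ Finset.range n, c m * n.choose (m + 1) := by
  induction n with
  | zero => simp
  | succ n ih =>
    have h : ∑ m ∈ Finset.range n, c m * n.choose (m + 1) =
        ∑ m ∈ Finset.range (n + 1), c m * n.choose (m + 1) := by
      simp [Finset.sum_range_succ]
    rw [Finset.sum_range_succ, ih, h, ← Finset.sum_add_distrib]
    refine Finset.sum_congr rfl fun m _ => ?_
    rw [Nat.choose_succ_succ]
    push_cast
    ring

lemma choose_div_succ (n m : ℕ) :
    (n.choose m : ℝ) / (m + 1) = (n + 1).choose (m + 1) / (n + 1) := by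
  rw [div_eq_div_iff (by positivity) (by positivity)]
  have := Nat.add_one_mul_choose_eq n m
  rw [mul_comm]
  exact_mod_cast this

lemma binomTransform_div (g : ℕ → ℝ) (n : ℕ) :
    binomTransform (fun m => g m / (m + 1)) n =
      (∑ i ∈ Finset.range (n + 1), binomTransform g i) / (n + 1) := by
  simp only [binomTransform]
  rw [sum_range_sum_mul_choose, Finset.sum_div]
  refine Finset.sum_congr rfl fun m _ => ?_
  rw [mul_div_assoc, ← choose_div_succ]
  ring

lemma sum_alternating_choose_succ_mul_sum (g : ℕ → ℝ) (n : ℕ) :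
    ∑ m ∈ Finset.range (n + 1),
      (-1) ^ m * (∑ i ∈ Finset.range (m + 1), g i) * (n + 1).choose (m + 1) =
      binomTransform g n := by
  have h : ∀ m, ((-1 : ℝ) ^ m * (∑ i ∈ Finset.range (m + 1), g i) * (n + 1).choose (m + 1)) =
      (-1) ^ m * g m * n.choose m +
        ((-1) ^ m * (∑ i ∈ Finset.range m, g i) * n.choose m -
          (-1) ^ (m + 1) * (∑ i ∈ Finset.range (m + 1), g i) * n.choose (m + 1)) := by
    intro m
    rw [Nat.choose_succ_succ, Finset.sum_range_succ]
    push_cast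
    ring
  rw [Finset.sum_congr rfl fun m _ => h m, Finset.sum_add_distrib, Finset.sum_range_sub']
  simp [binomTransform]

lemma binomTransform_sum_div (g : ℕ → ℝ) (n : ℕ) :
    binomTransform (fun m => (∑ i ∈ Finset.range (m + 1), g i) / (m + 1)) n =
      binomTransform g n / (n + 1) := by
  rw [← sum_alternating_choose_succ_mul_sum g n, binomTransform, Finset.sum_div]
  refine Finset.sum_congr rfl fun m _ => ?_
  rw [mul_div_assoc, ← choose_div_succ]
  ring

lemma binomTransform_one_div (n : ℕ) :
    binomTransform (fun m => 1 / ((m : ℝ) + 1)) n = 1 / ((n : ℝ) + 1) := by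
  have h : ∀ i, binomTransform (fun m => if m = 0 then 1 else 0) i = 1 := fun i => by
    simp [binomTransform]
  simpa [h] using binomTransform_sum_div (fun m => if m = 0 then 1 else 0) n

/-- Consecutive differences of a list, starting from `0`. -/
def diffs (L : List ℕ) : List ℕ := L.zipWith (fun a b => a - b) (0 :: L)

lemma zipWith_sub_concat (L : List ℕ) (x w : ℕ) :
    (L ++ [w]).zipWith (fun a b => a - b) (x :: (L ++ [w])) =
      L.zipWith (fun a b => a - b) (x :: L) ++ [w - (x :: L).getLast (by simp)] := by
  induction L generalizing x with
  | nil => simp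
  | cons y L ih => simpa using ih y

lemma diffs_concat (L : List ℕ) (w : ℕ) :
    diffs (L ++ [w]) = diffs L ++ [w - (0 :: L).getLast (by simp)] :=
  zipWith_sub_concat L 0 w

lemma sort_insert_of_lt (s : Finset ℕ) (w : ℕ) (h : ∀ x ∈ s, x < w) :
    (insert w s).sort (· ≤ ·) = s.sort (· ≤ ·) ++ [w] := by
  have hw : w ∉ s := fun hs => (h w hs).false
  refine List.Perm.eq_of_pairwise' (Finset.pairwise_sort _ _) ?_ ?_ (r := (· ≤ ·))
  · rw [List.pairwise_append]
    exact ⟨Finset.pairwise_sort _ _, by simp, by simpa using fun x hx => (h x hx).le⟩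
  · rw [List.perm_ext_iff_of_nodup (Finset.sort_nodup _ _)]
    · simp [or_comm]
    · rw [List.nodup_append]
      simpa using fun x hx => (h x hx).ne

/-- The complement of `A(k)` in `{1, …, wt(k) - 1}`. -/
def compl (k : List ℕ) : Finset ℕ := Finset.Icc 1 (k.sum - 1) \ Aset k

lemma lt_sum_of_mem_compl {k : List ℕ} {x : ℕ} (hx : x ∈ compl k) : x < k.sum := by
  simp only [compl, Finset.mem_sdiff, Finset.mem_Icc] at hx
  omega

lemma hdual_eq_diffs (k : List ℕ) :
    hdual k = diffs ((compl k).sort (· ≤ ·) ++ [k.sum]) := by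
  rw [← sort_insert_of_lt _ _ fun x hx => lt_sum_of_mem_compl hx]
  rfl

lemma Aset_concat_eq (l : List ℕ) (c : ℕ) :
    Aset (l ++ [c]) = (Finset.Ico 1 (l.length + 1)).image fun i => (l.take i).sum := by
  rw [Aset]
  ext x
  simp only [List.length_append, List.length_singleton, Finset.mem_image]
  refine exists_congr fun i => and_congr_right fun hi => ?_
  rw [List.take_append_of_le_length (by rw [Finset.mem_Ico] at hi; omega)]

lemma Aset_concat_concat (l : List ℕ) (c d : ℕ) :
    Aset (l ++ [c] ++ [d]) = insert (l ++ [c]).sum (Aset (l ++ [c])) := by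
  rw [Aset_concat_eq, Aset, List.length_append, List.length_singleton,
    Finset.Ico_add_one_right_eq_Icc, Finset.Icc_eq_cons_Ico (by omega)]
  rw [Finset.cons_eq_insert, Finset.image_insert]
  rw [List.take_of_length_le (by simp)]

lemma le_sum_of_mem_Aset {k : List ℕ} {x : ℕ} (hx : x ∈ Aset k) : x ≤ k.sum := by
  obtain ⟨i, -, rfl⟩ := Finset.mem_image.1 hx
  conv_rhs => rw [← List.take_append_drop i k, List.sum_append]
  omega

lemma lt_sum_of_mem_Aset_concat {l : List ℕ} {c x : ℕ} (hc : 1 ≤ c)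
    (hx : x ∈ Aset (l ++ [c])) : x < (l ++ [c]).sum := by
  rw [Aset_concat_eq, ← Aset_concat_eq l 0] at hx
  have := le_sum_of_mem_Aset hx
  simp only [List.sum_append, List.sum_singleton] at this ⊢
  omega

lemma compl_concat_succ (l : List ℕ) {c : ℕ} (hc : 1 ≤ c) :
    compl (l ++ [c + 1]) = insert (l ++ [c]).sum (compl (l ++ [c])) := by
  have hA : Aset (l ++ [c + 1]) = Aset (l ++ [c]) := by rw [Aset_concat_eq, Aset_concat_eq]
  have hlt := fun x => lt_sum_of_mem_Aset_concat (l := l) (x := x) hc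
  ext x
  have hx := hlt x
  simp only [compl, hA, Finset.mem_sdiff, Finset.mem_Icc, Finset.mem_insert, List.sum_append,
    List.sum_singleton] at hx ⊢
  by_cases h : x ∈ Aset (l ++ [c])
  · have := hx h
    simp only [h, not_true_eq_false, and_false, or_false, false_iff]
    omega
  · simp only [h, not_false_eq_true, and_true]
    omega

lemma compl_concat_one (l : List ℕ) {c : ℕ} (hc : 1 ≤ c) :
    compl (l ++ [c] ++ [1]) = compl (l ++ [c]) := by
  ext x
  simp only [compl, Aset_concat_concat, Finset.mem_sdiff, Finset.mem_Icc, Finset.mem_insert]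
  rw [List.sum_append, List.sum_singleton, not_or]
  have : 1 ≤ (l ++ [c]).sum := by simp; omega
  constructor
  · rintro ⟨h₁, h₂, h₃⟩
    exact ⟨by omega, h₃⟩
  · rintro ⟨h₁, h₃⟩
    exact ⟨by omega, by omega, h₃⟩

lemma hdual_concat_succ (l : List ℕ) {c : ℕ} (hc : 1 ≤ c) :
    hdual (l ++ [c + 1]) = hdual (l ++ [c]) ++ [1] := by
  rw [hdual_eq_diffs, compl_concat_succ l hc,
    sort_insert_of_lt _ _ fun x hx => lt_sum_of_mem_compl hx, diffs_concat, ← hdual_eq_diffs]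
  congr 2
  rw [List.getLast_cons (by simp), List.getLast_append_singleton]
  simp only [List.sum_append, List.sum_singleton]
  omega

lemma exists_hdual_concat (l : List ℕ) {c : ℕ} (hc : 1 ≤ c) :
    ∃ l' c', hdual (l ++ [c]) = l' ++ [c'] ∧ hdual (l ++ [c] ++ [1]) = l' ++ [c' + 1] := by
  refine ⟨_, _, (hdual_eq_diffs _).trans (diffs_concat _ _), ?_⟩
  rw [hdual_eq_diffs, compl_concat_one l hc, diffs_concat, List.sum_append (l₁ := l ++ [c]),
    List.sum_singleton]
  congr 2
  refine Nat.sub_add_comm ?_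
  have hmem := List.getLast_mem (l := 0 :: (compl (l ++ [c])).sort (· ≤ ·)) (by simp)
  rw [List.mem_cons] at hmem
  rcases hmem with h | h
  · rw [h]
    exact Nat.zero_le _
  · exact (lt_sum_of_mem_compl ((Finset.mem_sort _).1 h)).le

lemma hdual_singleton_one : hdual [1] = [1] := by
  have h : compl [1] = ∅ := by simp [compl]
  rw [hdual_eq_diffs, h]
  simp [diffs]

/-- Induction on nonempty indices: increase the last entry by one, or append a `1`. -/
lemma index_induction {P : List ℕ → Prop} (one : P [1])
    (succ : ∀ l c, 1 ≤ c → P (l ++ [c]) → P (l ++ [c + 1]))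
    (concat : ∀ l c, 1 ≤ c → P (l ++ [c]) → P (l ++ [c] ++ [1]))
    (k : List ℕ) (hk : k ≠ []) (hpos : ∀ x ∈ k, 0 < x) : P k := by
  induction k using List.reverseRecOn with
  | nil => exact absurd rfl hk
  | append_singleton l c ih =>
    have hc : 1 ≤ c := hpos c (by simp)
    have base : P (l ++ [1]) := by
      rcases List.eq_nil_or_concat l with rfl | ⟨l', c', rfl⟩
      · exact one
      · simp only [List.concat_eq_append] at ih hpos ⊢
        exact concat l' c' (hpos c' (by simp)) (ih (by simp) fun x hx => hpos x (List.mem_append_left _ hx))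
    clear hpos ih
    induction c, hc using Nat.le_induction with
    | base => exact base
    | succ c hc ih => exact succ l c hc (ih (by simp))

/-- Hoffman duality for the sums `s⋆`. -/
theorem binomTransform_sStar_hdual (k : List ℕ) (hk : k ≠ []) (hpos : ∀ x ∈ k, 0 < x) (n : ℕ) :
    binomTransform (fun m => sStar (hdual k) (m + 1)) n = sStar k (n + 1) := by
  revert n
  refine index_induction (P := fun k => ∀ n,
    binomTransform (fun m => sStar (hdual k) (m + 1)) n = sStar k (n + 1)) ?_ ?_ ?_ k hk hpos
  · intro n
    rw [hdual_singleton_one, sStar_singleton_one (by omega)]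
    simpa [sStar_singleton_one] using binomTransform_one_div n
  · intro l c hc ih n
    obtain ⟨l', c', h, -⟩ := exists_hdual_concat l hc
    rw [sStar_concat_succ _ _ (by omega), hdual_concat_succ l hc, ← ih, h]
    have hs : ∀ m, sStar (l' ++ [c'] ++ [1]) (m + 1) =
        (∑ i ∈ Finset.range (m + 1), sStar (l' ++ [c']) (i + 1)) / ((m : ℝ) + 1) := fun m => by
      rw [sStar_concat_concat_one _ _ (by omega), SStar_eq_sum_range, Nat.cast_succ]
    simp only [hs]
    rw [binomTransform_sum_div, Nat.cast_succ]
  · intro l c hc ih n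
    obtain ⟨l', c', h, h'⟩ := exists_hdual_concat l hc
    rw [sStar_concat_concat_one _ _ (by omega), SStar_eq_sum_range, h']
    have hs : ∀ m, sStar (l' ++ [c' + 1]) (m + 1) =
        sStar (l' ++ [c']) (m + 1) / ((m : ℝ) + 1) := fun m => by
      rw [sStar_concat_succ _ _ (by omega), Nat.cast_succ]
    simp only [hs]
    rw [binomTransform_div, Nat.cast_succ]
    simp only [← ih, h]

/-- The Newton series of `N ↦ S⋆(k, N)`. -/
theorem SStar_eq_newton_sum (k : List ℕ) (hk : k ≠ []) (hpos : ∀ x ∈ k, 0 < x) (N : ℕ) :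
    SStar k N =
      ∑ n ∈ Finset.range N, (-1) ^ n * sStar (hdual k) (n + 1) * N.choose (n + 1) := by
  rw [SStar_eq_sum_range, ← sum_range_sum_mul_choose]
  exact Finset.sum_congr rfl fun n _ => (binomTransform_sStar_hdual k hk hpos n).symm

lemma eq_of_sum_mul_choose_eq {a b : ℕ → ℂ}
    (h : ∀ N : ℕ, ∑ n ∈ Finset.range (N + 1), a n * (N.choose n : ℕ) =
      ∑ n ∈ Finset.range (N + 1), b n * (N.choose n : ℕ)) (n : ℕ) : a n = b n := by
  induction n using Nat.strong_induction_on with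
  | _ n ih =>
    have hn := h n
    rw [Finset.sum_range_succ, Finset.sum_range_succ,
      Finset.sum_congr rfl fun m hm => by rw [ih m (Finset.mem_range.1 hm)]] at hn
    simpa using hn

/-- Uniqueness of the interpolating Newton series: if
`Σ_{n=0}^N a_n binom(N,n) = S⋆(k,N)` for all `N ≥ 0`, then `a₀ = 0` and
`a_n = (-1)^{n-1} s⋆(k∨,n)` for `n ≥ 1`. -/
theorem newton_series_unique (k : List ℕ) (hk : k ≠ []) (hpos : ∀ x ∈ k, 0 < x)
    (a : ℕ → ℂ)
    (ha : ∀ N : ℕ, ∑ n ∈ Finset.range (N + 1), a n * (N.choose n : ℕ) =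
      ((SStar k N : ℝ) : ℂ)) :
    a 0 = 0 ∧ ∀ n : ℕ, 1 ≤ n →
      a n = (-1 : ℂ) ^ (n - 1) * ((sStar (hdual k) n : ℝ) : ℂ) := by
  let b : ℕ → ℂ
    | 0 => 0
    | n + 1 => (-1 : ℂ) ^ n * ((sStar (hdual k) (n + 1) : ℝ) : ℂ)
  have hab : ∀ n, a n = b n := eq_of_sum_mul_choose_eq fun N => by
    rw [ha, SStar_eq_newton_sum k hk hpos, Finset.sum_range_succ']
    simp [b]
  refine ⟨hab 0, fun n hn => ?_⟩
  obtain ⟨n, rfl⟩ := Nat.exists_eq_add_of_le' hn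
  exact hab (n + 1)

end Kawashima
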